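/- Let ω ∉ {ε, ab, ba, aba} be a factor of F_∞ with singular kernel sk(ω) = s_k, and let ω = μ₁ s_k μ₂ be its unique kernel decomposition. Then for every p ≥ 1, the occurrence of s_k inside the p-th occurrence ω_p of ω (starting |μ₁| letters after the start of ω_p) is exactly the p-th occurrence of s_k in F_∞; in other words, this correspondence is a bijection between the occurrences of ω in F_∞ and the occurrences of s_k in F_∞ preserving the enumeration order. -/

import Mathlib

/-- Finite Fibonacci words: `Fw k = σ^k(a)` where `a = false`, `b = true`,
`σ(a) = ab`, `σ(b) = a`; so `Fw (k+2) = Fw (k+1) ++ Fw k`. -/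
def Fw : ℕ → List Bool
  | 0 => [false]
  | 1 => [false, true]
  | (k+2) => Fw (k+1) ++ Fw k

/-- The infinite Fibonacci word `F_∞` (0-indexed): since `Fw (n+1)` has length
`fib (n+3) > n`, its `n`-th letter is the `n`-th letter of `F_∞`. -/
def fw (n : ℕ) : Bool := (Fw (n+1)).getD n false

/-- Singular words, with index shifted by one: `sw n = s_{n-1}`.
`sw 0 = s_{-1} = a`, and `sw (n+1) = s_n = β_n · F_n · α_n⁻¹` where
`α_n` is the last letter of `F_n` and `β_n` the other letter. -/
def sw : ℕ → List Bool
  | 0 => [false]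
  | (n+1) => (!((Fw n).getLastD false)) :: (Fw n).dropLast

/-- The factor of `F_∞` of length `n` starting at (0-indexed) position `i`. -/
def seg (i n : ℕ) : List Bool := (List.range n).map (fun t => fw (i + t))

/-- `w` occurs in `F_∞` at (0-indexed) position `i`. -/
def OccursAt (w : List Bool) (i : ℕ) : Prop := seg i w.length = w

/-- `w` is a factor of `F_∞`. -/
def IsFactor (w : List Bool) : Prop := ∃ i, OccursAt w i

/-- Starting position of the `(p+1)`-st occurrence of `w` in `F_∞`
(occurrences enumerated by starting position, 0-indexed: `occPos w 0`
is the first occurrence, i.e. the paper's `ω_1`). -/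
noncomputable def occPos (w : List Bool) (p : ℕ) : ℕ := Nat.nth (OccursAt w) p

/-- A finite word viewed as an element of the free group on the alphabet. -/
def listToFree (w : List Bool) : FreeGroup Bool := (w.map FreeGroup.of).prod

/-- The gap `ν_{w,p}` (0-indexed in `p`: `gap w 0` is the paper's `ν_{w,1}`)
between the `(p+1)`-st and `(p+2)`-nd occurrences of `w`, as an element of the
free group: the separating word if the occurrences are separated or adjacent,
and the formal inverse of the overlap if they overlap. -/
noncomputable def gap (w : List Bool) (p : ℕ) : FreeGroup Bool :=
  if occPos w p + w.length ≤ occPos w (p+1) then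
    listToFree (seg (occPos w p + w.length) (occPos w (p+1) - (occPos w p + w.length)))
  else
    (listToFree (seg (occPos w (p+1)) (occPos w p + w.length - occPos w (p+1))))⁻¹

/-- The signed length `|ν_{w,p}|` of the gap (negative in the overlapped case). -/
noncomputable def gapLen (w : List Bool) (p : ℕ) : ℤ :=
  (occPos w (p+1) : ℤ) - ((occPos w p : ℤ) + (w.length : ℤ))

/-- `u` is a singular word (some `s_k`, `k ≥ -1`). -/
def IsSingular (u : List Bool) : Prop := ∃ n, u = sw n

/-- `u` is a singular kernel of `w`: a singular factor of `w` of maximal length. -/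
def IsKernelOf (u w : List Bool) : Prop :=
  IsSingular u ∧ u <:+: w ∧ ∀ v : List Bool, IsSingular v → v <:+: w → v.length ≤ u.length

/-- The excluded words `{ε, ab, ba, aba}`. -/
def excl : List (List Bool) := [[], [false, true], [true, false], [false, true, false]]

/-- The `i`-th conjugate `C_i(w)` (indices taken mod the length). -/
def conj (i : ℕ) (w : List Bool) : List Bool :=
  w.drop (i % w.length) ++ w.take (i % w.length)

/-- `sliceW u i j = u[i,j]`, the letters `i` through `j` of `u`, 1-indexed. -/
def sliceW (u : List Bool) (i j : ℕ) : List Bool := (u.take j).drop (i - 1)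

/-! ### Occurrences -/

theorem occursAt_iff_forall {w : List Bool} {i : ℕ} :
    OccursAt w i ↔ ∀ (t : ℕ) (h : t < w.length), fw (i + t) = w[t] := by
  unfold OccursAt seg
  constructor
  · intro h t ht
    have := congrArg (fun l => l[t]?) h
    simpa [ht] using this
  · intro h
    apply List.ext_getElem
    · simp
    · intro t h1 h2
      simpa using h t h2

theorem occursAt_nil (i : ℕ) : OccursAt [] i := rfl

theorem occursAt_cons {c : Bool} {w : List Bool} {i : ℕ} :
    OccursAt (c :: w) i ↔ fw i = c ∧ OccursAt w (i + 1) := by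
  simp only [occursAt_iff_forall]
  constructor
  · intro h
    refine ⟨h 0 (by simp), fun t ht => ?_⟩
    have := h (t + 1) (by simpa using ht)
    rw [show i + 1 + t = i + (t + 1) by omega, this]
    simp
  · rintro ⟨h0, h⟩ t ht
    cases t with
    | zero => simpa using h0
    | succ t =>
      have := h t (by simpa using ht)
      rw [show i + (t + 1) = i + 1 + t by omega, this]
      simp

theorem occursAt_append {u v : List Bool} {i : ℕ} :
    OccursAt (u ++ v) i ↔ OccursAt u i ∧ OccursAt v (i + u.length) := by
  induction u generalizing i with
  | nil => simp [occursAt_nil]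
  | cons c u ih =>
    rw [List.cons_append, occursAt_cons, occursAt_cons, ih, List.length_cons,
      show i + 1 + u.length = i + (u.length + 1) by omega, and_assoc]

theorem occursAt_singleton {c : Bool} {i : ℕ} : OccursAt [c] i ↔ fw i = c := by
  simp [occursAt_cons, occursAt_nil]

/-- An occurrence lying inside an occurrence of `w` yields a factor of `w`. -/
theorem OccursAt.isInfix {v w : List Bool} {i j : ℕ} (hv : OccursAt v j) (hw : OccursAt w i)
    (hle : i ≤ j) (hend : j + v.length ≤ i + w.length) : v <:+: w := by
  have hv_eq : v = (w.drop (j - i)).take v.length := by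
    apply List.ext_getElem
    · simp; omega
    · intro t h1 h2
      rw [List.getElem_take, List.getElem_drop,
        ← occursAt_iff_forall.1 hv t h1, ← occursAt_iff_forall.1 hw (j - i + t) (by omega)]
      congr 1
      omega
  rw [hv_eq]
  exact (List.take_prefix _ _).isInfix.trans (List.drop_suffix _ _).isInfix

/-! ### The Fibonacci morphism -/

/-- The Fibonacci morphism `a ↦ ab`, `b ↦ a`. -/
def fibMorph (w : List Bool) : List Bool :=
  w.flatMap fun c => if c then [false] else [false, true]

theorem fibMorph_nil : fibMorph [] = [] := rfl

theorem fibMorph_cons_true (w : List Bool) : fibMorph (true :: w) = false :: fibMorph w := by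
  simp [fibMorph]

theorem fibMorph_cons_false (w : List Bool) :
    fibMorph (false :: w) = false :: true :: fibMorph w := by
  simp [fibMorph]

theorem fibMorph_append (u v : List Bool) : fibMorph (u ++ v) = fibMorph u ++ fibMorph v := by
  simp [fibMorph]

theorem fibMorph_Fw (n : ℕ) : fibMorph (Fw n) = Fw (n + 1) := by
  induction n using Nat.twoStepInduction with
  | zero => rfl
  | one => rfl
  | more n ih1 ih2 =>
    rw [Fw, fibMorph_append, ih1, ih2]
    rfl

theorem Fw_prefix_succ (n : ℕ) : Fw n <+: Fw (n + 1) := by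
  cases n with
  | zero => exact ⟨[true], rfl⟩
  | succ n => exact ⟨Fw n, rfl⟩

theorem Fw_prefix {m n : ℕ} (h : m ≤ n) : Fw m <+: Fw n := by
  induction h with
  | refl => exact List.prefix_rfl
  | step _ ih => exact ih.trans (Fw_prefix_succ _)

theorem lt_length_Fw (n : ℕ) : n < (Fw n).length := by
  induction n using Nat.twoStepInduction with
  | zero => simp [Fw]
  | one => simp [Fw]
  | more n ih1 ih2 =>
    rw [Fw, List.length_append]
    omega

theorem occursAt_Fw_zero (n : ℕ) : OccursAt (Fw n) 0 := by
  rw [occursAt_iff_forall]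
  intro t ht
  have ht' : t < (Fw (t + 1)).length := (Nat.lt_succ_self t).trans (lt_length_Fw (t + 1))
  rw [zero_add, fw, List.getD_eq_getElem _ _ ht']
  rcases le_total n (t + 1) with h | h
  · exact ((Fw_prefix h).getElem ht).symm
  · exact (Fw_prefix h).getElem ht'

theorem occursAt_fibMorph_seg_zero (i : ℕ) : OccursAt (fibMorph (seg 0 i)) 0 := by
  have hpre : seg 0 i <+: Fw i := by
    have : seg 0 i = (Fw i).take i := by
      apply List.ext_getElem
      · simpa [seg] using (lt_length_Fw i).le
      · intro t h1 h2
        have := occursAt_iff_forall.1 (occursAt_Fw_zero i) t (by simp at h2; omega)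
        simpa [seg] using this
    rw [this]
    exact List.take_prefix _ _
  obtain ⟨r, hr⟩ := hpre
  have h := occursAt_Fw_zero (i + 1)
  rw [← fibMorph_Fw, ← hr, fibMorph_append] at h
  exact (occursAt_append.1 h).1

/-- The position at which the image of the `i`-th letter starts when `F_∞` is read as the
image of itself under the Fibonacci morphism. -/
def blockStart : ℕ → ℕ
  | 0 => 0
  | (i+1) => blockStart i + if fw i then 1 else 2

theorem seg_zero_succ (i : ℕ) : seg 0 (i + 1) = seg 0 i ++ [fw i] := by
  simp [seg, List.range_succ]

theorem length_fibMorph_seg_zero (i : ℕ) : (fibMorph (seg 0 i)).length = blockStart i := by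
  induction i with
  | zero => rfl
  | succ i ih =>
    rw [seg_zero_succ, fibMorph_append, List.length_append, ih, blockStart]
    cases fw i <;> rfl

theorem occursAt_fibMorph_letter (i : ℕ) : OccursAt (fibMorph [fw i]) (blockStart i) := by
  have h := occursAt_fibMorph_seg_zero (i + 1)
  rw [seg_zero_succ, fibMorph_append] at h
  simpa [length_fibMorph_seg_zero] using (occursAt_append.1 h).2

theorem fw_blockStart (i : ℕ) : fw (blockStart i) = false := by
  have h := occursAt_fibMorph_letter i
  cases hi : fw i <;> rw [hi] at h
  · exact (occursAt_cons.1 h).1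
  · exact (occursAt_cons.1 h).1

theorem blockStart_succ_of_true {i : ℕ} (h : fw i = true) :
    blockStart (i + 1) = blockStart i + 1 := by
  simp [blockStart, h]

theorem blockStart_succ_of_false {i : ℕ} (h : fw i = false) :
    blockStart (i + 1) = blockStart i + 2 := by
  simp [blockStart, h]

theorem fw_blockStart_add_one (i : ℕ) : fw (blockStart i + 1) = !fw i := by
  cases hi : fw i
  · have h := occursAt_fibMorph_letter i
    rw [hi] at h
    exact (occursAt_cons.1 (occursAt_cons.1 h).2).1
  · rw [← blockStart_succ_of_true hi, fw_blockStart]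
    rfl

theorem blockStart_strictMono : StrictMono blockStart := by
  apply strictMono_nat_of_lt_succ
  intro i
  rw [blockStart]
  split <;> omega

theorem exists_blockStart (j : ℕ) :
    ∃ i, j = blockStart i ∨ (j = blockStart i + 1 ∧ fw i = false) := by
  induction j with
  | zero => exact ⟨0, Or.inl rfl⟩
  | succ j ih =>
    obtain ⟨i, rfl | ⟨rfl, hi⟩⟩ := ih
    · cases hi : fw i
      · exact ⟨i, Or.inr ⟨rfl, hi⟩⟩
      · exact ⟨i + 1, Or.inl (blockStart_succ_of_true hi).symm⟩
    · exact ⟨i + 1, Or.inl (blockStart_succ_of_false hi).symm⟩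

theorem exists_blockStart_of_false {j : ℕ} (hj : fw j = false) : ∃ i, j = blockStart i := by
  obtain ⟨i, rfl | ⟨rfl, hi⟩⟩ := exists_blockStart j
  · exact ⟨i, rfl⟩
  · simp [fw_blockStart_add_one, hi] at hj

theorem exists_blockStart_of_true {j : ℕ} (hj : fw j = true) :
    ∃ i, j = blockStart i + 1 ∧ fw i = false := by
  obtain ⟨i, rfl | h⟩ := exists_blockStart j
  · simp [fw_blockStart] at hj
  · exact ⟨i, h⟩

theorem fw_succ_of_true {j : ℕ} (hj : fw j = true) : fw (j + 1) = false := by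
  obtain ⟨i, rfl, hi⟩ := exists_blockStart_of_true hj
  rw [add_assoc, ← blockStart_succ_of_false hi, fw_blockStart]

theorem OccursAt.fw_eq_of_fibMorph {w : List Bool} {i : ℕ}
    (h : OccursAt (fibMorph w ++ [false]) i) : fw i = false := by
  cases w with
  | nil => exact (occursAt_cons.1 h).1
  | cons c w => cases c <;> exact (occursAt_cons.1 h).1

/-- Desubstitution: `σ(w)a` occurs at the start of a block exactly when `w` occurs at the
corresponding position. -/
theorem occursAt_fibMorph_iff {w : List Bool} {i : ℕ} :
    OccursAt (fibMorph w ++ [false]) (blockStart i) ↔ OccursAt w i := by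
  induction w generalizing i with
  | nil => simp [fibMorph_nil, occursAt_singleton, fw_blockStart, occursAt_nil]
  | cons c w ih =>
    rw [occursAt_cons, ← ih]
    cases c
    · simp only [fibMorph_cons_false, List.cons_append, occursAt_cons, fw_blockStart,
        fw_blockStart_add_one, true_and]
      cases hi : fw i
      · simp [blockStart_succ_of_false hi]
      · simp
    · simp only [fibMorph_cons_true, List.cons_append, occursAt_cons, fw_blockStart, true_and]
      cases hi : fw i
      · simp only [Bool.false_eq_true, false_and, iff_false]
        intro h
        have := h.fw_eq_of_fibMorph
        simp [fw_blockStart_add_one, hi] at this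
      · simp [blockStart_succ_of_true hi]

theorem OccursAt.blockStart_add_length {w : List Bool} {i : ℕ} (h : OccursAt w i) :
    blockStart (i + w.length) = blockStart i + (fibMorph w).length := by
  induction w generalizing i with
  | nil => rfl
  | cons c w ih =>
    obtain ⟨hc, hw⟩ := occursAt_cons.1 h
    rw [List.length_cons, show i + (w.length + 1) = i + 1 + w.length by omega, ih hw]
    cases c
    · rw [blockStart_succ_of_false hc, fibMorph_cons_false]
      simp; omega
    · rw [blockStart_succ_of_true hc, fibMorph_cons_true]
      simp; omega

/-! ### Central words -/

/-- The central words: `centralWord n` is `Fw (n+1)` without its last two letters. -/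
def centralWord : ℕ → List Bool
  | 0 => []
  | 1 => [false]
  | (n+2) => Fw (n+2) ++ centralWord n

/-- The penultimate letter of `Fw (n+1)`. -/
def penult : ℕ → Bool
  | 0 => false
  | (n+1) => !penult n

theorem Fw_succ_eq (n : ℕ) : Fw (n + 1) = centralWord n ++ [penult n, !penult n] := by
  induction n using Nat.twoStepInduction with
  | zero => rfl
  | one => rfl
  | more n ih1 ih2 =>
    rw [Fw, ih1, centralWord]
    simp [penult]

theorem centralWord_add_two (n : ℕ) :
    centralWord (n + 2) = Fw (n + 1) ++ centralWord (n + 1) := by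
  induction n with
  | zero => rfl
  | succ n ih =>
    rw [centralWord, Fw, List.append_assoc, ← ih]

theorem fibMorph_centralWord (n : ℕ) :
    centralWord (n + 1) = fibMorph (centralWord n) ++ [false] := by
  induction n using Nat.twoStepInduction with
  | zero => rfl
  | one => rfl
  | more n ih1 ih2 =>
    rw [centralWord, ih1, centralWord, fibMorph_append, fibMorph_Fw, List.append_assoc]

theorem sw_add_two (n : ℕ) : sw (n + 2) = penult n :: (centralWord n ++ [penult n]) := by
  rw [sw, Fw_succ_eq]
  have : centralWord n ++ [penult n, !penult n] = (centralWord n ++ [penult n]) ++ [!penult n] := by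
    simp
  rw [this, List.dropLast_concat, List.getLastD_concat]
  simp

theorem sw_add_two_of_penult_false {n : ℕ} (h : penult n = false) :
    sw (n + 2) = fibMorph (sw (n + 1)) ++ [false] := by
  cases n with
  | zero => rfl
  | succ n =>
    rw [sw_add_two, sw_add_two, fibMorph_centralWord, h]
    rw [penult, Bool.not_eq_false'] at h
    simp [h, fibMorph_cons_true, fibMorph_append, fibMorph_nil]

theorem cons_sw_add_two_of_penult_true {n : ℕ} (h : penult n = true) :
    false :: sw (n + 2) = fibMorph (sw (n + 1)) := by
  cases n with
  | zero => cases h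
  | succ n =>
    rw [sw_add_two, sw_add_two, fibMorph_centralWord, h]
    rw [penult, Bool.not_eq_true'] at h
    simp [h, fibMorph_cons_false, fibMorph_append, fibMorph_nil]

theorem length_sw_succ (n : ℕ) : (sw (n + 1)).length = (Fw n).length := by
  have := lt_length_Fw n
  simp [sw]
  omega

theorem length_Fw_succ (n : ℕ) : (Fw (n + 1)).length = (centralWord n).length + 2 := by
  simp [Fw_succ_eq]

theorem length_centralWord_add_two (n : ℕ) :
    (centralWord (n + 2)).length = 2 * (centralWord n).length + 2 + (sw (n + 1)).length := by
  rw [centralWord, List.length_append, Fw, List.length_append, length_Fw_succ, length_sw_succ]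
  omega

theorem length_Fw_lt_succ (n : ℕ) : (Fw n).length < (Fw (n + 1)).length := by
  cases n with
  | zero => simp [Fw]
  | succ n =>
    have := lt_length_Fw n
    rw [Fw, List.length_append]
    omega

theorem infinite_occursAt_centralWord (n : ℕ) : {i | OccursAt (centralWord n) i}.Infinite := by
  induction n with
  | zero => simpa [centralWord, occursAt_nil] using Set.infinite_univ
  | succ n ih =>
    refine (ih.image blockStart_strictMono.injective.injOn).mono ?_
    rintro _ ⟨i, hi, rfl⟩
    rw [Set.mem_ofPred_eq, fibMorph_centralWord]
    exact occursAt_fibMorph_iff.2 hi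

/-- Every occurrence of a singular word sits in the middle of an occurrence of a central word. -/
theorem OccursAt.exists_centralWord {n i : ℕ} (h : OccursAt (sw (n + 1)) i) :
    ∃ j, i = j + (centralWord n).length + 1 ∧ OccursAt (centralWord (n + 2)) j := by
  induction n generalizing i with
  | zero =>
    have hi : fw i = true := occursAt_singleton.1 h
    obtain ⟨k, rfl, hk⟩ := exists_blockStart_of_true hi
    refine ⟨blockStart k, rfl, ?_⟩
    have : centralWord 2 = [false, true, false] := rfl
    simp [this, occursAt_cons, occursAt_nil, fw_blockStart, hi, fw_succ_of_true hi]
  | succ n ih =>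
    have key : ∀ k, OccursAt (sw (n + 1)) k → ∃ j, OccursAt (centralWord (n + 3)) j ∧
        blockStart k + 1 =
          j + (centralWord (n + 1)).length + (if penult n then 1 else 2) := by
      intro k hk
      obtain ⟨j, rfl, hj⟩ := ih hk
      refine ⟨blockStart j, ?_, ?_⟩
      · rw [fibMorph_centralWord]
        exact occursAt_fibMorph_iff.2 hj
      · have hpre : OccursAt (centralWord n ++ [penult n]) j := by
          rw [centralWord_add_two, Fw_succ_eq, List.append_assoc] at hj
          obtain ⟨h1, h2⟩ := occursAt_append.1 hj
          exact occursAt_append.2 ⟨h1, occursAt_singleton.2 (occursAt_cons.1 h2).1⟩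
        have := hpre.blockStart_add_length
        rw [List.length_append, List.length_singleton, ← add_assoc] at this
        rw [this, fibMorph_centralWord, fibMorph_append]
        cases penult n
        · simp [fibMorph]
          omega
        · simp [fibMorph]
    cases hp : penult n
    · rw [sw_add_two_of_penult_false hp] at h
      obtain ⟨k, rfl⟩ := exists_blockStart_of_false h.fw_eq_of_fibMorph
      obtain ⟨j, hj, hlen⟩ := key k (occursAt_fibMorph_iff.1 h)
      exact ⟨j, by simp [hp] at hlen; omega, hj⟩
    · have hb : OccursAt [true] i ∧ OccursAt [true] (i + ((centralWord n).length + 1)) := by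
        have h' := h
        rw [sw_add_two, hp, ← List.cons_append] at h'
        obtain ⟨h1, h2⟩ := occursAt_append.1 h'
        exact ⟨occursAt_singleton.2 (occursAt_cons.1 h1).1, by simpa using h2⟩
      obtain ⟨k, rfl, -⟩ := exists_blockStart_of_true (occursAt_singleton.1 hb.1)
      have hk : OccursAt (sw (n + 1)) k := by
        rw [← occursAt_fibMorph_iff, ← cons_sw_add_two_of_penult_true hp]
        refine occursAt_append.2 ⟨occursAt_cons.2 ⟨fw_blockStart k, h⟩, ?_⟩
        have := fw_succ_of_true (occursAt_singleton.1 hb.2)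
        rw [occursAt_singleton, ← this, sw_add_two]
        congr 1
        simp
        omega
      obtain ⟨j, hj, hlen⟩ := key k hk
      exact ⟨j, by simp [hp] at hlen; omega, hj⟩

/-! ### Kernel decompositions -/

theorem length_sw_lt_add_two (n : ℕ) : (sw (n + 1)).length < (sw (n + 2)).length := by
  rw [length_sw_succ, length_sw_succ]
  exact length_Fw_lt_succ n

/-- A word of `F_∞` extending an occurrence of `centralWord (n+2)` to the left by one letter
contains a longer singular word. -/
theorem exists_sw_of_left {n j : ℕ} (h : OccursAt (centralWord (n + 2)) (j + 1)) :
    OccursAt (sw (n + 2)) j ∨ OccursAt (sw (n + 3)) j := by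
  have aux : ∀ (k : ℕ) (v : List Bool), centralWord (n + 2) = Fw (k + 1) ++ v →
      fw j = penult k → OccursAt (sw (k + 2)) j := by
    intro k v hv hj
    rw [hv, Fw_succ_eq, List.append_assoc] at h
    obtain ⟨h1, h2⟩ := occursAt_append.1 h
    rw [sw_add_two]
    exact occursAt_cons.2 ⟨hj, occursAt_append.2
      ⟨h1, occursAt_singleton.2 (occursAt_cons.1 h2).1⟩⟩
  by_cases hj : fw j = penult n
  · exact Or.inl (aux n _ (centralWord_add_two n) hj)
  · refine Or.inr (aux (n + 1) (centralWord n) rfl ?_)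
    rw [penult]
    exact Bool.eq_not_of_ne hj

/-- A word of `F_∞` extending an occurrence of `centralWord (n+2)` to the right by one letter
contains a longer singular word. -/
theorem exists_sw_of_right {n j : ℕ} (h : OccursAt (centralWord (n + 2)) j) :
    (∃ i, j ≤ i ∧ i + (sw (n + 2)).length = j + (centralWord (n + 2)).length + 1 ∧
      OccursAt (sw (n + 2)) i) ∨
    (∃ i, j ≤ i ∧ i + (sw (n + 3)).length = j + (centralWord (n + 2)).length + 1 ∧
      OccursAt (sw (n + 3)) i) := by
  have aux : ∀ (k l : ℕ), penult k = !penult l →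
      centralWord (n + 2) = Fw (l + 1) ++ centralWord k →
      fw (j + (centralWord (n + 2)).length) = penult k →
      ∃ i, j ≤ i ∧ i + (sw (k + 2)).length = j + (centralWord (n + 2)).length + 1 ∧
        OccursAt (sw (k + 2)) i := by
    intro k l hkl hv hj
    have hlen := congrArg List.length hv
    rw [hv, Fw_succ_eq, show centralWord l ++ [penult l, !penult l] =
      (centralWord l ++ [penult l]) ++ [!penult l] by simp, List.append_assoc] at h
    obtain ⟨-, h2⟩ := occursAt_append.1 h
    simp only [List.length_append, length_Fw_succ] at hlen
    refine ⟨j + (centralWord l ++ [penult l]).length, by omega, ?_, ?_⟩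
    · rw [sw_add_two]
      simp
      omega
    · rw [sw_add_two, ← List.cons_append, hkl]
      refine occursAt_append.2 ⟨h2, occursAt_singleton.2 ?_⟩
      rw [← hkl, ← hj]
      congr 1
      simp
      omega
  by_cases hj : fw (j + (centralWord (n + 2)).length) = penult n
  · exact Or.inl (aux n (n + 1) (by simp [penult]) rfl hj)
  · refine Or.inr (aux (n + 1) n rfl (centralWord_add_two n) ?_)
    rw [penult]
    exact Bool.eq_not_of_ne hj

/-- In a kernel decomposition with kernel `s_n`, both outer words are short. -/
theorem IsKernelOf.length_le {w u v : List Bool} {n i j : ℕ} (hker : IsKernelOf (sw (n + 1)) w)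
    (hdec : w = u ++ sw (n + 1) ++ v) (hw : OccursAt w i)
    (hj : OccursAt (centralWord (n + 2)) j) (hij : i + u.length = j + (centralWord n).length + 1) :
    u.length ≤ (centralWord n).length + 1 ∧ v.length ≤ (centralWord n).length + 1 := by
  have hlt := length_sw_lt_add_two n
  have hlt' : (sw (n + 2)).length < (sw (n + 3)).length := length_sw_lt_add_two (n + 1)
  have hmax : ∀ k p, (sw (n + 1)).length < (sw k).length → OccursAt (sw k) p → i ≤ p →
      ¬ p + (sw k).length ≤ i + w.length := by
    intro k p hk hp hip hend
    exact absurd (hker.2.2 (sw k) ⟨k, rfl⟩ (hp.isInfix hw hip hend)) (by omega)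
  have hwlen := congrArg List.length hdec
  simp only [List.length_append] at hwlen
  have hlen := length_centralWord_add_two n
  have h2 : (sw (n + 2)).length = (centralWord n).length + 2 := by simp [sw_add_two]
  have h3 : (sw (n + 3)).length = (sw (n + 2)).length + (sw (n + 1)).length := by
    simp only [length_sw_succ, Fw, List.length_append]
  have hpos : 0 < (sw (n + 1)).length := by
    rw [length_sw_succ]
    exact (Nat.zero_le n).trans_lt (lt_length_Fw n)
  by_contra hcon
  by_cases hu : u.length ≤ (centralWord n).length + 1
  · rcases exists_sw_of_right hj with ⟨p, hp, hpe, hocc⟩ | ⟨p, hp, hpe, hocc⟩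
    · exact hmax _ p hlt hocc (by omega) (by omega)
    · exact hmax _ p (hlt.trans hlt') hocc (by omega) (by omega)
  · obtain ⟨j, rfl⟩ : ∃ j', j = j' + 1 := ⟨j - 1, by omega⟩
    rcases exists_sw_of_left hj with hocc | hocc
    · exact hmax _ j hlt hocc (by omega) (by omega)
    · exact hmax _ j (hlt.trans hlt') hocc (by omega) (by omega)

/-- Only the word `a` itself has kernel `a`, apart from the excluded words. -/
theorem IsKernelOf.eq_singleton {w : List Bool} (hfac : IsFactor w) (hne : w ∉ excl)
    (hker : IsKernelOf (sw 0) w) : w = [false] := by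
  obtain ⟨i, hi⟩ := hfac
  have haa : ¬ [false, false] <:+: w := fun h => by
    simpa [sw] using hker.2.2 [false, false] ⟨2, rfl⟩ h
  have hbab : ¬ [true, false, true] <:+: w := fun h => by
    simpa [sw] using hker.2.2 [true, false, true] ⟨3, rfl⟩ h
  have hbb : ¬ [true, true] <:+: w := by
    rintro ⟨s, t, rfl⟩
    have h := (occursAt_append.1 (occursAt_append.1 hi).1).2
    simp only [occursAt_cons] at h
    simpa [h.2.1] using fw_succ_of_true h.1
  have ha : [false] <:+: w := hker.2.1
  clear hi hker
  match w with
  | [] => simp [excl] at hne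
  | [x] => revert x; decide
  | [x, y] => revert x y; decide
  | [x, y, z] => revert x y z; decide
  | x :: y :: z :: t :: w =>
    have hpre : ∀ v, v <:+: [x, y, z, t] → v <:+: x :: y :: z :: t :: w := fun v hv =>
      hv.trans (List.prefix_append [x, y, z, t] w).isInfix
    have hcontains : ∀ x y z t : Bool, [false, false] <:+: [x, y, z, t] ∨
        [true, true] <:+: [x, y, z, t] ∨ [true, false, true] <:+: [x, y, z, t] := by
      decide
    rcases hcontains x y z t with h | h | h
    · exact absurd (hpre _ h) haa
    · exact absurd (hpre _ h) hbb
    · exact absurd (hpre _ h) hbab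

theorem nth_eq_nth_add {P Q : ℕ → Prop} {d : ℕ} (hQ : {i | Q i}.Infinite)
    (hQP : ∀ i, Q i → P (i + d)) (hPQ : ∀ i, P i → ∃ j, i = j + d ∧ Q j) (p : ℕ) :
    Nat.nth P p = Nat.nth Q p + d := by
  have hQ_eq : Q = fun i => P (i + d) := by
    funext i
    refine propext ⟨hQP i, fun h => ?_⟩
    obtain ⟨j, hj, hq⟩ := hPQ _ h
    rwa [Nat.add_right_cancel hj]
  have hP : {i | P i}.Infinite :=
    (hQ.image (add_left_injective d).injOn).mono (by rintro _ ⟨i, hi, rfl⟩; exact hQP i hi)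
  subst hQ_eq
  refine (Nat.nth_comp_of_strictMono (p := P) (f := fun i => i + d)
    (strictMono_id.add_const d) (fun k hk => ?_) (fun hfin => absurd hfin hP)).symm
  obtain ⟨j, rfl, -⟩ := hPQ k hk
  exact ⟨j, rfl⟩

/-- if `ω ∉ {ε,ab,ba,aba}` is a factor of `F_∞` with kernel
decomposition `ω = μ₁ · s_k · μ₂` (here `sw m = s_{m-1}` is the kernel), then for
every `p` the copy of the kernel inside the `p`-th occurrence of `ω` (starting
`|μ₁|` letters later) is exactly the `p`-th occurrence of the kernel in `F_∞`. -/
theorem stmt6 (ω μ₁ μ₂ : List Bool) (m : ℕ) (hfac : IsFactor ω) (hne : ω ∉ excl)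
    (hker : IsKernelOf (sw m) ω) (hdec : ω = μ₁ ++ sw m ++ μ₂) :
    ∀ p : ℕ, occPos (sw m) p = occPos ω p + μ₁.length := by
  cases m with
  | zero =>
    obtain rfl := hker.eq_singleton hfac hne
    have hlen := congrArg List.length hdec
    simp [sw] at hlen
    simp [sw, show μ₁ = [] from List.length_eq_zero_iff.1 (by omega)]
  | succ n =>
    have hkernel : ∀ i, OccursAt ω i → OccursAt (sw (n + 1)) (i + μ₁.length) := by
      intro i hi
      rw [hdec] at hi
      exact (occursAt_append.1 (occursAt_append.1 hi).1).2
    obtain ⟨i₀, hi₀⟩ := hfac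
    obtain ⟨j₀, hij, hj₀⟩ := (hkernel i₀ hi₀).exists_centralWord
    obtain ⟨h1, h2⟩ := hker.length_le hdec hi₀ hj₀ hij
    have hlen := congrArg List.length hdec
    simp only [List.length_append] at hlen
    have hclen := length_centralWord_add_two n
    obtain ⟨d, hd⟩ := Nat.exists_eq_add_of_le h1
    have hcopy : ∀ j, OccursAt (centralWord (n + 2)) j → OccursAt ω (j + d) := by
      intro j hj
      rw [occursAt_iff_forall] at hj hj₀ hi₀ ⊢
      intro t ht
      rw [← hi₀ t ht, show i₀ + t = j₀ + (d + t) by omega, add_assoc,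
        hj (d + t) (by omega), hj₀ (d + t) (by omega)]
    refine nth_eq_nth_add ?_ hkernel ?_
    · refine ((infinite_occursAt_centralWord (n + 2)).image (add_left_injective d).injOn).mono ?_
      rintro _ ⟨j, hj, rfl⟩
      exact hcopy j hj
    · intro i hi
      obtain ⟨j, rfl, hj⟩ := hi.exists_centralWord
      exact ⟨j + d, by omega, hcopy j hj⟩
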